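/- arXiv:2009.08207 — 6 statements merged into one kernel-verified Lean document; each statement's English description precedes it below -/
import Mathlib

section
/- Let p, e, s : (0,∞)×(0,∞) → ℝ be continuously differentiable functions satisfying Gibbs' equation, assume ∂s/∂ϑ(ϱ,ϑ) ≠ 0 for all ϱ,ϑ > 0, and let H : 𝓔 → ℝ be differentiable on an open set 𝓔 ⊆ ℝ² containing the range of (ϱ,ϑ) ↦ (ϱ, ϱ·s(ϱ,ϑ)) with H(ϱ, ϱ·s(ϱ,ϑ)) = ϱ·e(ϱ,ϑ) for all ϱ,ϑ > 0. Then the pressure satisfies the Euler-type identity p(ϱ,ϑ) = ϱ·∂H/∂ϱ(ϱ,S) + S·∂H/∂S(ϱ,S) − H(ϱ,S) at S = ϱ·s(ϱ,ϑ), for all ϱ,ϑ > 0. -/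
open Set Filter Topology

noncomputable section

/-- The open positive quadrant `(0,∞) × (0,∞)` in the `(ϱ,ϑ)`-plane. -/
def posQuad : Set (ℝ × ℝ) := {q : ℝ × ℝ | 0 < q.1 ∧ 0 < q.2}

/-- Partial derivative of a two-variable function in the first (density) variable. -/
def pd1 (f : ℝ → ℝ → ℝ) (ρ θ : ℝ) : ℝ :=
  fderiv ℝ (fun q : ℝ × ℝ => f q.1 q.2) (ρ, θ) (1, 0)

/-- Partial derivative of a two-variable function in the second (temperature) variable. -/
def pd2 (f : ℝ → ℝ → ℝ) (ρ θ : ℝ) : ℝ :=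
  fderiv ℝ (fun q : ℝ × ℝ => f q.1 q.2) (ρ, θ) (0, 1)

/-- Gibbs' equation in the standard variables. -/
def GibbsEq (p e s : ℝ → ℝ → ℝ) : Prop :=
  ∀ ρ θ : ℝ, 0 < ρ → 0 < θ →
    θ * pd2 s ρ θ = pd2 e ρ θ ∧
    θ * pd1 s ρ θ = pd1 e ρ θ - p ρ θ / ρ ^ 2

/-- `posQuad` is open. -/
theorem isOpen_posQuad : IsOpen posQuad :=
  (isOpen_lt continuous_const continuous_fst).inter (isOpen_lt continuous_const continuous_snd)

/-- A `C¹` function on the open quadrant has its `fderiv` as derivative at each point. -/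
theorem hasFDerivAt_of_contDiffOn_posQuad {f : ℝ × ℝ → ℝ} (hf : ContDiffOn ℝ 1 f posQuad)
    {q : ℝ × ℝ} (hq : q ∈ posQuad) : HasFDerivAt f (fderiv ℝ f q) q :=
  ((hf.differentiableOn one_ne_zero).differentiableAt
    (isOpen_posQuad.mem_nhds hq)).hasFDerivAt

/-- A linear functional on `ℝ × ℝ` is determined by its values on the standard basis. -/
theorem apply_prod_eq_mul_add_mul (L : ℝ × ℝ →L[ℝ] ℝ) (x y : ℝ) :
    L (x, y) = x * L (1, 0) + y * L (0, 1) := by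
  rw [← smul_eq_mul, ← smul_eq_mul, ← map_smul, ← map_smul, ← map_add]
  simp

/-- the Euler-type identity
`p = ϱ ∂H/∂ϱ + S ∂H/∂S − H` at `S = ϱ s(ϱ,ϑ)`. -/
theorem pressure_euler_identity
    (p e s : ℝ → ℝ → ℝ)
    (hp : ContDiffOn ℝ 1 (fun q : ℝ × ℝ => p q.1 q.2) posQuad)
    (he : ContDiffOn ℝ 1 (fun q : ℝ × ℝ => e q.1 q.2) posQuad)
    (hs : ContDiffOn ℝ 1 (fun q : ℝ × ℝ => s q.1 q.2) posQuad)
    (hGibbs : GibbsEq p e s)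
    (hsθ : ∀ ρ θ : ℝ, 0 < ρ → 0 < θ → pd2 s ρ θ ≠ 0)
    (𝓔 : Set (ℝ × ℝ)) (h𝓔 : IsOpen 𝓔)
    (hrange : ∀ ρ θ : ℝ, 0 < ρ → 0 < θ → (ρ, ρ * s ρ θ) ∈ 𝓔)
    (H : ℝ × ℝ → ℝ) (hH : DifferentiableOn ℝ H 𝓔)
    (hHe : ∀ ρ θ : ℝ, 0 < ρ → 0 < θ → H (ρ, ρ * s ρ θ) = ρ * e ρ θ) :
    ∀ ρ θ : ℝ, 0 < ρ → 0 < θ →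
      p ρ θ = ρ * fderiv ℝ H (ρ, ρ * s ρ θ) (1, 0)
        + (ρ * s ρ θ) * fderiv ℝ H (ρ, ρ * s ρ θ) (0, 1)
        - H (ρ, ρ * s ρ θ) := by
  intro ρ θ hρ hθ
  have hq : (ρ, θ) ∈ posQuad := ⟨hρ, hθ⟩
  have ds := hasFDerivAt_of_contDiffOn_posQuad hs hq
  have de := hasFDerivAt_of_contDiffOn_posQuad he hq
  have dfst : HasFDerivAt (fun q : ℝ × ℝ => q.1) (ContinuousLinearMap.fst ℝ ℝ ℝ) (ρ, θ) :=
    hasFDerivAt_fst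
  have dH : HasFDerivAt H (fderiv ℝ H (ρ, ρ * s ρ θ)) (ρ, ρ * s ρ θ) :=
    (hH.differentiableAt (h𝓔.mem_nhds (hrange ρ θ hρ hθ))).hasFDerivAt
  have dcomp := HasFDerivAt.comp (f := fun q : ℝ × ℝ => (q.1, q.1 * s q.1 q.2)) (ρ, θ) dH
    (dfst.prodMk (dfst.mul ds))
  have heq : (fun q : ℝ × ℝ => q.1 * e q.1 q.2) =ᶠ[𝓝 (ρ, θ)]
      H ∘ fun q : ℝ × ℝ => (q.1, q.1 * s q.1 q.2) := by
    filter_upwards [isOpen_posQuad.mem_nhds hq] with q hq'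
    exact (hHe q.1 q.2 hq'.1 hq'.2).symm
  have chain := (dcomp.congr_of_eventuallyEq heq).unique (dfst.mul de)
  have chain_ρ := DFunLike.congr_fun chain (1, 0)
  have chain_θ := DFunLike.congr_fun chain (0, 1)
  simp only [ContinuousLinearMap.comp_apply, ContinuousLinearMap.prod_apply,
    add_apply, smul_apply, ContinuousLinearMap.coe_fst',
    smul_eq_mul, apply_prod_eq_mul_add_mul (fderiv ℝ H _) _ (_ + _)] at chain_ρ chain_θ
  obtain ⟨gibbs_θ, gibbs_ρ⟩ := hGibbs ρ θ hρ hθ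
  have hH_S : fderiv ℝ H (ρ, ρ * s ρ θ) (0, 1) = θ := by
    refine mul_left_cancel₀ (mul_ne_zero hρ.ne' (hsθ ρ θ hρ hθ)) ?_
    unfold pd2 at *
    linear_combination chain_θ - ρ * gibbs_θ
  have hp_eq : p ρ θ = ρ ^ 2 * (pd1 e ρ θ - θ * pd1 s ρ θ) := by
    rw [gibbs_ρ]
    field_simp
    ring
  rw [hHe ρ θ hρ hθ, hp_eq, hH_S]
  rw [hH_S] at chain_ρ
  unfold pd1
  linear_combination -ρ * chain_ρ

end
end

section
/- Let p, e, s : (0,∞)×(0,∞) → ℝ be twice continuously differentiable functions satisfying Gibbs' equation, and suppose the hypothesis of thermodynamic stability holds: ∂p/∂ϱ(ϱ,ϑ) > 0 and ∂e/∂ϑ(ϱ,ϑ) > 0 for all ϱ,ϑ > 0. Assume moreover ∂s/∂ϑ(ϱ,ϑ) > 0 for all ϱ,ϑ > 0, and let H : 𝓔 → ℝ be twice differentiable on an open set 𝓔 ⊆ ℝ² containing the range of (ϱ,ϑ) ↦ (ϱ, ϱ·s(ϱ,ϑ)) with H(ϱ, ϱ·s(ϱ,ϑ)) = ϱ·e(ϱ,ϑ)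 for all ϱ,ϑ > 0. Then at every point (ϱ, ϱ·s(ϱ,ϑ)) with ϱ,ϑ > 0, the second derivative of H (as a symmetric bilinear form on ℝ²) is positive definite. -/
open Set Filter Topology

noncomputable section

/-- The total derivative of a two-variable function is assembled from its partial derivatives. -/
theorem fderiv_apply_eq_pd (f : ℝ → ℝ → ℝ) (q w : ℝ × ℝ) :
    fderiv ℝ (fun q : ℝ × ℝ => f q.1 q.2) q w = w.1 * pd1 f q.1 q.2 + w.2 * pd2 f q.1 q.2 := by
  have hw : w = w.1 • ((1, 0) : ℝ × ℝ) + w.2 • ((0, 1) : ℝ × ℝ) := by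
    ext <;> simp
  conv_lhs => rw [hw]
  rw [map_add, map_smul, map_smul]
  rfl

theorem differentiableAt_of_contDiffOn_posQuad {f : ℝ → ℝ → ℝ}
    (hf : ContDiffOn ℝ 2 (fun q : ℝ × ℝ => f q.1 q.2) posQuad) {q : ℝ × ℝ} (hq : q ∈ posQuad) :
    DifferentiableAt ℝ (fun q : ℝ × ℝ => f q.1 q.2) q :=
  (hf.contDiffAt (isOpen_posQuad.mem_nhds hq)).differentiableAt (by norm_num)

/-- Passage from the standard variables to the conservative–entropy variables. -/
def entropyMap (s : ℝ → ℝ → ℝ) (q : ℝ × ℝ) : ℝ × ℝ := (q.1, q.1 * s q.1 q.2)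

/-- The derivative of `entropyMap`. -/
def entropyMapDeriv (s : ℝ → ℝ → ℝ) (q : ℝ × ℝ) : ℝ × ℝ →L[ℝ] ℝ × ℝ :=
  (ContinuousLinearMap.fst ℝ ℝ ℝ).prod
    (q.1 • fderiv ℝ (fun q : ℝ × ℝ => s q.1 q.2) q + s q.1 q.2 • ContinuousLinearMap.fst ℝ ℝ ℝ)

theorem hasFDerivAt_entropyMap {s : ℝ → ℝ → ℝ} {q : ℝ × ℝ}
    (hs : DifferentiableAt ℝ (fun q : ℝ × ℝ => s q.1 q.2) q) :
    HasFDerivAt (entropyMap s) (entropyMapDeriv s q) q :=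
  hasFDerivAt_fst.prodMk (hasFDerivAt_fst.mul hs.hasFDerivAt)

theorem entropyMapDeriv_apply (s : ℝ → ℝ → ℝ) (q w : ℝ × ℝ) :
    entropyMapDeriv s q w =
      (w.1, q.1 * (w.1 * pd1 s q.1 q.2 + w.2 * pd2 s q.1 q.2) + s q.1 q.2 * w.1) := by
  rw [← fderiv_apply_eq_pd]
  rfl

theorem entropyMapDeriv_surjective {s : ℝ → ℝ → ℝ} {q : ℝ × ℝ} (hq : q.1 ≠ 0)
    (hsθ : pd2 s q.1 q.2 ≠ 0) : Function.Surjective (entropyMapDeriv s q) := by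
  intro v
  refine ⟨(v.1, ((v.2 - s q.1 q.2 * v.1) / q.1 - v.1 * pd1 s q.1 q.2) / pd2 s q.1 q.2), ?_⟩
  rw [entropyMapDeriv_apply]
  ext
  · rfl
  · simp only
    field_simp
    ring

/-- The gradient of the internal energy: its `S`-derivative is the temperature and its
`ϱ`-derivative is the Gibbs free energy `e - ϑ s + p / ϱ`. -/
theorem fderiv_internalEnergy_apply {p e s : ℝ → ℝ → ℝ} (hGibbs : GibbsEq p e s)
    {H : ℝ × ℝ → ℝ}
    (hHe : ∀ ρ θ : ℝ, 0 < ρ → 0 < θ → H (ρ, ρ * s ρ θ) = ρ * e ρ θ)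
    {q : ℝ × ℝ} (hq : q ∈ posQuad)
    (he : DifferentiableAt ℝ (fun q : ℝ × ℝ => e q.1 q.2) q)
    (hs : DifferentiableAt ℝ (fun q : ℝ × ℝ => s q.1 q.2) q)
    (hsθ : pd2 s q.1 q.2 ≠ 0) (hH : DifferentiableAt ℝ H (entropyMap s q)) (v : ℝ × ℝ) :
    fderiv ℝ H (entropyMap s q) v =
      (e q.1 q.2 - q.2 * s q.1 q.2 + p q.1 q.2 * q.1⁻¹) * v.1 + q.2 * v.2 := by
  have hq1 : q.1 ≠ 0 := hq.1.ne'
  have hcomp := hH.hasFDerivAt.comp q (hasFDerivAt_entropyMap hs)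
  have hmul : HasFDerivAt (fun q : ℝ × ℝ => q.1 * e q.1 q.2) _ q :=
    hasFDerivAt_fst.mul he.hasFDerivAt
  have heq : (H ∘ entropyMap s) =ᶠ[𝓝 q] fun q => q.1 * e q.1 q.2 := by
    filter_upwards [isOpen_posQuad.mem_nhds hq] with r hr using hHe r.1 r.2 hr.1 hr.2
  have hchain := hcomp.unique (hmul.congr_of_eventuallyEq heq)
  obtain ⟨w, rfl⟩ := entropyMapDeriv_surjective hq1 hsθ v
  have hw := DFunLike.congr_fun hchain w
  simp only [ContinuousLinearMap.comp_apply, add_apply,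
    smul_apply, smul_eq_mul, fderiv_apply_eq_pd,
    ContinuousLinearMap.coe_fst'] at hw
  obtain ⟨hg2, hg1⟩ := hGibbs q.1 q.2 hq.1 hq.2
  rw [hw, entropyMapDeriv_apply, ← hg2, show pd1 e q.1 q.2 =
    q.2 * pd1 s q.1 q.2 + p q.1 q.2 / q.1 ^ 2 by linarith]
  simp only
  field_simp
  ring

/-- The Hessian of the internal energy, with its first argument pulled back to the standard
variables. -/
theorem fderiv_fderiv_internalEnergy_apply {p e s : ℝ → ℝ → ℝ} (hGibbs : GibbsEq p e s)
    (hp : ContDiffOn ℝ 2 (fun q : ℝ × ℝ => p q.1 q.2) posQuad)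
    (he : ContDiffOn ℝ 2 (fun q : ℝ × ℝ => e q.1 q.2) posQuad)
    (hs : ContDiffOn ℝ 2 (fun q : ℝ × ℝ => s q.1 q.2) posQuad)
    (hsθ : ∀ ρ θ : ℝ, 0 < ρ → 0 < θ → 0 < pd2 s ρ θ)
    {H : ℝ × ℝ → ℝ} (hH : ∀ q ∈ posQuad, ContDiffAt ℝ 2 H (entropyMap s q))
    (hHe : ∀ ρ θ : ℝ, 0 < ρ → 0 < θ → H (ρ, ρ * s ρ θ) = ρ * e ρ θ)
    {q : ℝ × ℝ} (hq : q ∈ posQuad) (w v : ℝ × ℝ) :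
    fderiv ℝ (fderiv ℝ H) (entropyMap s q) (entropyMapDeriv s q w) v =
      (w.1 * (pd1 p q.1 q.2 / q.1) + w.2 * (pd2 p q.1 q.2 / q.1 - s q.1 q.2)) * v.1
        + w.2 * v.2 := by
  have hq1 : q.1 ≠ 0 := hq.1.ne'
  have dp := differentiableAt_of_contDiffOn_posQuad hp hq
  have de := differentiableAt_of_contDiffOn_posQuad he hq
  have ds := differentiableAt_of_contDiffOn_posQuad hs hq
  have dH : DifferentiableAt ℝ (fderiv ℝ H) (entropyMap s q) :=
    ((hH q hq).fderiv_right (m := 1) (by norm_num)).differentiableAt (by norm_num)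
  have hleft := (dH.hasFDerivAt.comp q (hasFDerivAt_entropyMap ds)).clm_apply
    (hasFDerivAt_const v q)
  have hinv : HasFDerivAt (fun q : ℝ × ℝ => q.1⁻¹) _ q :=
    (hasDerivAt_inv hq1).comp_hasFDerivAt q (hasFDerivAt_fst (𝕜 := ℝ) (p := q))
  have hright := ((((de.hasFDerivAt.sub (hasFDerivAt_snd.mul ds.hasFDerivAt)).add
    (dp.hasFDerivAt.mul hinv)).mul (hasFDerivAt_const v.1 q)).add
    (hasFDerivAt_snd.mul (hasFDerivAt_const v.2 q)))
  have heq : (fun r => (fderiv ℝ H ∘ entropyMap s) r v) =ᶠ[𝓝 q] fun q =>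
      (e q.1 q.2 - q.2 * s q.1 q.2 + p q.1 q.2 * q.1⁻¹) * v.1 + q.2 * v.2 := by
    filter_upwards [isOpen_posQuad.mem_nhds hq] with r hr
    exact fderiv_internalEnergy_apply hGibbs hHe hr
      (differentiableAt_of_contDiffOn_posQuad he hr)
      (differentiableAt_of_contDiffOn_posQuad hs hr) (hsθ r.1 r.2 hr.1 hr.2).ne'
      ((hH r hr).differentiableAt (by norm_num)) v
  have hw := DFunLike.congr_fun (hleft.unique (hright.congr_of_eventuallyEq heq)) w
  simp [fderiv_apply_eq_pd] at hw
  obtain ⟨hg2, hg1⟩ := hGibbs q.1 q.2 hq.1 hq.2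
  rw [hw, ← hg2, show pd1 e q.1 q.2 =
    q.2 * pd1 s q.1 q.2 + p q.1 q.2 / q.1 ^ 2 by linarith]
  field_simp
  ring

/-- under the hypothesis of thermodynamic stability
(`∂p/∂ϱ > 0`, `∂e/∂ϑ > 0`), the Hessian of the internal energy `H(ϱ,S)` in the
conservative–entropy variables is positive definite at every point `(ϱ, ϱ s(ϱ,ϑ))`. -/
theorem internal_energy_hessian_positive_definite
    (p e s : ℝ → ℝ → ℝ)
    (hp : ContDiffOn ℝ 2 (fun q : ℝ × ℝ => p q.1 q.2) posQuad)
    (he : ContDiffOn ℝ 2 (fun q : ℝ × ℝ => e q.1 q.2) posQuad)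
    (hs : ContDiffOn ℝ 2 (fun q : ℝ × ℝ => s q.1 q.2) posQuad)
    (hGibbs : GibbsEq p e s)
    (hstab_p : ∀ ρ θ : ℝ, 0 < ρ → 0 < θ → 0 < pd1 p ρ θ)
    (hstab_e : ∀ ρ θ : ℝ, 0 < ρ → 0 < θ → 0 < pd2 e ρ θ)
    (hsθ : ∀ ρ θ : ℝ, 0 < ρ → 0 < θ → 0 < pd2 s ρ θ)
    (𝓔 : Set (ℝ × ℝ)) (h𝓔 : IsOpen 𝓔)
    (hrange : ∀ ρ θ : ℝ, 0 < ρ → 0 < θ → (ρ, ρ * s ρ θ) ∈ 𝓔)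
    (H : ℝ × ℝ → ℝ) (hH : ContDiffOn ℝ 2 H 𝓔)
    (hHe : ∀ ρ θ : ℝ, 0 < ρ → 0 < θ → H (ρ, ρ * s ρ θ) = ρ * e ρ θ) :
    ∀ ρ θ : ℝ, 0 < ρ → 0 < θ →
      ∀ v : ℝ × ℝ, v ≠ 0 →
        0 < fderiv ℝ (fderiv ℝ H) (ρ, ρ * s ρ θ) v v := by
  intro ρ θ hρ hθ v hv
  have hq : ((ρ, θ) : ℝ × ℝ) ∈ posQuad := ⟨hρ, hθ⟩
  have hHat : ∀ q ∈ posQuad, ContDiffAt ℝ 2 H (entropyMap s q) := fun q hq =>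
    hH.contDiffAt (h𝓔.mem_nhds (hrange q.1 q.2 hq.1 hq.2))
  have hess := fderiv_fderiv_internalEnergy_apply hGibbs hp he hs hsθ hHat hHe hq
  have hsymm : IsSymmSndFDerivAt ℝ H (entropyMap s (ρ, θ)) :=
    (hHat _ hq).isSymmSndFDerivAt (by simp)
  have hs2 := hsθ ρ θ hρ hθ
  have hp1 := hstab_p ρ θ hρ hθ
  have maxwell : pd2 p ρ θ / ρ + ρ * pd1 s ρ θ = 0 := by
    have h := hsymm.eq (entropyMapDeriv s (ρ, θ) (0, 1)) (entropyMapDeriv s (ρ, θ) (1, 0))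
    rw [hess, hess] at h
    simp only [entropyMapDeriv_apply] at h
    linarith
  obtain ⟨w, rfl⟩ := entropyMapDeriv_surjective (q := (ρ, θ)) hρ.ne' hs2.ne' v
  have hquad : fderiv ℝ (fderiv ℝ H) (ρ, ρ * s ρ θ) (entropyMapDeriv s (ρ, θ) w)
      (entropyMapDeriv s (ρ, θ) w) = pd1 p ρ θ / ρ * w.1 ^ 2 + ρ * pd2 s ρ θ * w.2 ^ 2 := by
    refine (hess w _).trans ?_
    simp only [entropyMapDeriv_apply]
    linear_combination w.1 * w.2 * maxwell
  rw [hquad]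
  by_cases hw1 : w.1 = 0
  · have hw2 : w.2 ≠ 0 := fun hw2 => hv (by rw [show w = 0 from Prod.ext hw1 hw2, map_zero])
    positivity
  · positivity

end
end

section
/- Let e, s : (0,∞)×(0,∞) → ℝ be continuously differentiable and satisfy ϑ·∂s/∂ϑ(ϱ,ϑ) = ∂e/∂ϑ(ϱ,ϑ) (the ϑ-component of Gibbs' equation), and assume ∂e/∂ϑ(ϱ,ϑ) > 0 for all ϱ,ϑ > 0. Then for every fixed ϱ > 0 and ϑ > 0, the function ϑ̃ ↦ e(ϱ,ϑ̃) − ϑ·s(ϱ,ϑ̃) on (0,∞) attains a strict global minimum at ϑ̃ = ϑ; in particular e(ϱ,ϑ̃) − ϑ·s(ϱ,ϑ̃) ≥ e(ϱ,ϑ) − ϑ·s(ϱ,ϑ) for all ϑ̃ > 0, with equality only for ϑ̃ = ϑ. -/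
open Set Filter Topology

noncomputable section

/-- A function of class `C¹` on the positive quadrant has partial derivative `pd2` there. -/
theorem hasDerivAt_pd2 {f : ℝ → ℝ → ℝ}
    (hf : ContDiffOn ℝ 1 (fun q : ℝ × ℝ => f q.1 q.2) posQuad) {ρ t : ℝ}
    (hρ : 0 < ρ) (ht : 0 < t) : HasDerivAt (f ρ) (pd2 f ρ t) t := by
  have hopen : IsOpen posQuad :=
    (isOpen_lt continuous_const continuous_fst).inter (isOpen_lt continuous_const continuous_snd)
  have hd : DifferentiableAt ℝ (fun q : ℝ × ℝ => f q.1 q.2) (ρ, t) :=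
    (hf.differentiableOn one_ne_zero).differentiableAt (hopen.mem_nhds ⟨hρ, ht⟩)
  exact hd.hasFDerivAt.comp_hasDerivAt t ((hasDerivAt_const t ρ).prodMk (hasDerivAt_id t))

/-- A function on `(0,∞)` whose derivative at `t` has the sign of `t - a` has a strict global
minimum at `a`. -/
theorem lt_of_hasDerivAt_sign {g g' : ℝ → ℝ} {a b : ℝ} (ha : 0 < a) (hb : 0 < b) (hab : b ≠ a)
    (hg : ∀ t, 0 < t → HasDerivAt g (g' t) t)
    (hneg : ∀ t, 0 < t → t < a → g' t < 0) (hpos : ∀ t, a < t → 0 < g' t) : g a < g b := by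
  rcases lt_or_gt_of_ne hab with h | h
  · refine strictAntiOn_of_deriv_neg (convex_Icc b a)
      (fun t ht => (hg t (hb.trans_le ht.1)).continuousAt.continuousWithinAt) (fun t ht => ?_)
      (left_mem_Icc.2 h.le) (right_mem_Icc.2 h.le) h
    rw [interior_Icc] at ht
    have ht0 := hb.trans ht.1
    rw [(hg t ht0).deriv]
    exact hneg t ht0 ht.2
  · refine strictMonoOn_of_deriv_pos (convex_Icc a b)
      (fun t ht => (hg t (ha.trans_le ht.1)).continuousAt.continuousWithinAt) (fun t ht => ?_)
      (left_mem_Icc.2 h.le) (right_mem_Icc.2 h.le) h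
    rw [interior_Icc] at ht
    rw [(hg t (ha.trans ht.1)).deriv]
    exact hpos t ht.1

/-- under the `ϑ`-component of Gibbs' equation and `∂e/∂ϑ > 0`,
for fixed `ϱ, ϑ > 0` the function `ϑ̃ ↦ e(ϱ,ϑ̃) − ϑ s(ϱ,ϑ̃)` attains a strict global
minimum on `(0,∞)` at `ϑ̃ = ϑ`. -/
theorem ballistic_free_energy_strict_min
    (e s : ℝ → ℝ → ℝ)
    (he : ContDiffOn ℝ 1 (fun q : ℝ × ℝ => e q.1 q.2) posQuad)
    (hs : ContDiffOn ℝ 1 (fun q : ℝ × ℝ => s q.1 q.2) posQuad)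
    (hGibbsθ : ∀ ρ θ : ℝ, 0 < ρ → 0 < θ → θ * pd2 s ρ θ = pd2 e ρ θ)
    (heθ : ∀ ρ θ : ℝ, 0 < ρ → 0 < θ → 0 < pd2 e ρ θ) :
    ∀ ρ θ : ℝ, 0 < ρ → 0 < θ →
      (∀ θ' : ℝ, 0 < θ' → e ρ θ - θ * s ρ θ ≤ e ρ θ' - θ * s ρ θ') ∧
      (∀ θ' : ℝ, 0 < θ' → θ' ≠ θ → e ρ θ - θ * s ρ θ < e ρ θ' - θ * s ρ θ') := by
  intro ρ θ hρ hθ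
  have hs_pos : ∀ t, 0 < t → 0 < pd2 s ρ t := fun t ht =>
    pos_of_mul_pos_right (hGibbsθ ρ t hρ ht ▸ heθ ρ t hρ ht) ht.le
  have hderiv : ∀ t, 0 < t →
      HasDerivAt (fun t => e ρ t - θ * s ρ t) ((t - θ) * pd2 s ρ t) t := fun t ht => by
    rw [sub_mul, hGibbsθ ρ t hρ ht]
    exact (hasDerivAt_pd2 he hρ ht).sub ((hasDerivAt_pd2 hs hρ ht).const_mul θ)
  have hlt : ∀ θ' : ℝ, 0 < θ' → θ' ≠ θ → e ρ θ - θ * s ρ θ < e ρ θ' - θ * s ρ θ' :=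
    fun θ' hθ' hne => lt_of_hasDerivAt_sign hθ hθ' hne hderiv
      (fun t ht h => mul_neg_of_neg_of_pos (sub_neg.2 h) (hs_pos t ht))
      (fun t h => mul_pos (sub_pos.2 h) (hs_pos t (hθ.trans h)))
  refine ⟨fun θ' hθ' => ?_, hlt⟩
  rcases eq_or_ne θ' θ with rfl | hne
  · exact le_rfl
  · exact (hlt θ' hθ' hne).le

end
end

section
/- Let p, e, s : (0,∞)×(0,∞) → ℝ be continuously differentiable functions satisfying Gibbs' equation with ∂s/∂ϑ > 0 everywhere, let 𝓔 ⊆ ℝ² be an open convex set containing the range of (ϱ,ϑ) ↦ (ϱ, ϱ·s(ϱ,ϑ)), and let H : 𝓔 → ℝ be a convex differentiable function with H(ϱ, ϱ·s(ϱ,ϑ)) = ϱ·e(ϱ,ϑ) for all ϱ,ϑ > 0. Then for all ϱ, ϱ_b, ϑ > 0: ϱ_b·( e(ϱ,ϑ) − ϑ·s(ϱ,ϑ) + p(ϱ,ϑ)/ϱ ) − p(ϱ,ϑ) ≤ ϱ_b·e(ϱ_b,ϑ) − ϑ·ϱ_b·s(ϱ_b,ϑ). -/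
open Set Filter Topology

noncomputable section

/-- First-order characterization of convexity: the graph lies above its tangent plane. -/
lemma ConvexOn.add_hasFDerivAt_le {E : Type*} [NormedAddCommGroup E] [NormedSpace ℝ E]
    {S : Set E} {f : E → ℝ} {f' : E →L[ℝ] ℝ} {x y : E} (hf : ConvexOn ℝ S f)
    (hx : x ∈ S) (hy : y ∈ S) (hf' : HasFDerivAt f f' x) :
    f x + f' (y - x) ≤ f y := by
  have hderiv : HasDerivAt (f ∘ AffineMap.lineMap x y) (f' (y - x)) (0 : ℝ) :=
    HasFDerivAt.comp_hasDerivAt (0 : ℝ) (by simpa using hf') AffineMap.hasDerivAt_lineMap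
  have hslope := (hf.comp_affineMap (AffineMap.lineMap x y)).le_slope_of_hasDerivAt
    (x := (0 : ℝ)) (y := 1) (by simpa using hx) (by simpa using hy) one_pos hderiv
  simp only [slope_def_field, Function.comp_apply, AffineMap.lineMap_apply_one,
    AffineMap.lineMap_apply_zero, sub_zero, div_one] at hslope
  linarith

lemma posQuad_mem_nhds {ρ θ : ℝ} (hρ : 0 < ρ) (hθ : 0 < θ) : posQuad ∈ 𝓝 (ρ, θ) :=
  ((isOpen_lt continuous_const continuous_fst).inter
    (isOpen_lt continuous_const continuous_snd)).mem_nhds ⟨hρ, hθ⟩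

lemma hasFDerivAt_fst_mul {f : ℝ → ℝ → ℝ} {ρ θ : ℝ}
    (hf : DifferentiableAt ℝ (fun q : ℝ × ℝ => f q.1 q.2) (ρ, θ)) :
    HasFDerivAt (fun q : ℝ × ℝ => q.1 * f q.1 q.2)
      (ρ • fderiv ℝ (fun q : ℝ × ℝ => f q.1 q.2) (ρ, θ) +
        f ρ θ • ContinuousLinearMap.fst ℝ ℝ ℝ) (ρ, θ) :=
  hasFDerivAt_fst.mul hf.hasFDerivAt

/-- In the conservative–entropy variables, the differential of the internal energy is
`(e - θ s + p / ρ) dρ + θ dS`. -/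
lemma GibbsEq.fderiv_internalEnergy {p e s : ℝ → ℝ → ℝ} (hGibbs : GibbsEq p e s)
    {H : ℝ × ℝ → ℝ} {H' : ℝ × ℝ →L[ℝ] ℝ} {ρ θ : ℝ} (hρ : 0 < ρ) (hθ : 0 < θ)
    (he : DifferentiableAt ℝ (fun q : ℝ × ℝ => e q.1 q.2) (ρ, θ))
    (hs : DifferentiableAt ℝ (fun q : ℝ × ℝ => s q.1 q.2) (ρ, θ))
    (hsθ : pd2 s ρ θ ≠ 0)
    (hH : HasFDerivAt H H' (ρ, ρ * s ρ θ))
    (hHe : ∀ ρ θ : ℝ, 0 < ρ → 0 < θ → H (ρ, ρ * s ρ θ) = ρ * e ρ θ) (v : ℝ × ℝ) :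
    H' v = (e ρ θ - θ * s ρ θ + p ρ θ / ρ) * v.1 + θ * v.2 := by
  have hcomp : HasFDerivAt (fun q : ℝ × ℝ => H (q.1, q.1 * s q.1 q.2)) _ (ρ, θ) :=
    HasFDerivAt.comp (g := H) (f := fun q : ℝ × ℝ => (q.1, q.1 * s q.1 q.2)) (ρ, θ) hH
      (hasFDerivAt_fst.prodMk (hasFDerivAt_fst_mul hs))
  have heq : (fun q : ℝ × ℝ => q.1 * e q.1 q.2) =ᶠ[𝓝 (ρ, θ)]
      fun q => H (q.1, q.1 * s q.1 q.2) := by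
    filter_upwards [posQuad_mem_nhds hρ hθ] with q hq
    exact (hHe q.1 q.2 hq.1 hq.2).symm
  have hfd := (hcomp.congr_of_eventuallyEq heq).unique (hasFDerivAt_fst_mul he)
  have hsplit (w : ℝ × ℝ) : H' w = w.1 * H' (1, 0) + w.2 * H' (0, 1) := by
    rw [← smul_eq_mul, ← smul_eq_mul, ← map_smul, ← map_smul, ← map_add]
    simp
  have hdρ := DFunLike.congr_fun hfd (1, 0)
  have hdθ := DFunLike.congr_fun hfd (0, 1)
  simp only [ContinuousLinearMap.comp_apply, ContinuousLinearMap.prod_apply,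
    add_apply, smul_apply, ContinuousLinearMap.coe_fst',
    smul_eq_mul, mul_one, mul_zero, add_zero] at hdρ hdθ
  rw [hsplit] at hdρ hdθ
  obtain ⟨hGθ, hGρ⟩ := hGibbs ρ θ hρ hθ
  simp only [pd1, pd2] at hGθ hGρ hsθ
  have hS : H' (0, 1) = θ := by
    rw [← hGθ] at hdθ
    refine mul_left_cancel₀ (mul_ne_zero hρ.ne' hsθ) ?_
    linarith
  have hρ' : H' (1, 0) = e ρ θ - θ * s ρ θ + p ρ θ / ρ := by
    have hp : ρ * (p ρ θ / ρ ^ 2) = p ρ θ / ρ := by field_simp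
    rw [hS] at hdρ
    linear_combination hdρ - ρ * hGρ + hp
  rw [hsplit, hS, hρ']
  ring

/-- the convexity estimate used to control the inflow boundary terms:
`ϱ_b (e(ϱ,ϑ) − ϑ s(ϱ,ϑ) + p(ϱ,ϑ)/ϱ) − p(ϱ,ϑ) ≤ ϱ_b e(ϱ_b,ϑ) − ϑ ϱ_b s(ϱ_b,ϑ)`. -/
theorem inflow_convexity_estimate
    (p e s : ℝ → ℝ → ℝ)
    (hp : ContDiffOn ℝ 1 (fun q : ℝ × ℝ => p q.1 q.2) posQuad)
    (he : ContDiffOn ℝ 1 (fun q : ℝ × ℝ => e q.1 q.2) posQuad)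
    (hs : ContDiffOn ℝ 1 (fun q : ℝ × ℝ => s q.1 q.2) posQuad)
    (hGibbs : GibbsEq p e s)
    (hsθ : ∀ ρ θ : ℝ, 0 < ρ → 0 < θ → 0 < pd2 s ρ θ)
    (𝓔 : Set (ℝ × ℝ)) (h𝓔 : IsOpen 𝓔) (h𝓔conv : Convex ℝ 𝓔)
    (hrange : ∀ ρ θ : ℝ, 0 < ρ → 0 < θ → (ρ, ρ * s ρ θ) ∈ 𝓔)
    (H : ℝ × ℝ → ℝ) (hHconv : ConvexOn ℝ 𝓔 H) (hH : DifferentiableOn ℝ H 𝓔)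
    (hHe : ∀ ρ θ : ℝ, 0 < ρ → 0 < θ → H (ρ, ρ * s ρ θ) = ρ * e ρ θ) :
    ∀ ρ ρb θ : ℝ, 0 < ρ → 0 < ρb → 0 < θ →
      ρb * (e ρ θ - θ * s ρ θ + p ρ θ / ρ) - p ρ θ
        ≤ ρb * e ρb θ - θ * (ρb * s ρb θ) := by
  intro ρ ρb θ hρ hρb hθ
  have hmem := posQuad_mem_nhds hρ hθ
  have hH' := (hH.differentiableAt (h𝓔.mem_nhds (hrange ρ θ hρ hθ))).hasFDerivAt
  have htangent := hHconv.add_hasFDerivAt_le (hrange ρ θ hρ hθ) (hrange ρb θ hρb hθ) hH'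
  rw [hGibbs.fderiv_internalEnergy hρ hθ ((he.differentiableOn one_ne_zero).differentiableAt hmem)
    ((hs.differentiableOn one_ne_zero).differentiableAt hmem) (hsθ ρ θ hρ hθ).ne' hH' hHe,
    hHe ρ θ hρ hθ, hHe ρb θ hρb hθ] at htangent
  have hp : p ρ θ / ρ * ρ = p ρ θ := div_mul_cancel₀ _ hρ.ne'
  simp only [Prod.fst_sub, Prod.snd_sub] at htangent
  linarith

end
end

section
/- Let d ≥ 1 and let U ⊆ ℝ × ℝ^d be open. Let ϱ, ϑ : U → ℝ be continuously differentiable with ϱ > 0 and ϑ > 0 on U, let u, q : U → ℝ^d and 𝕊 : U → ℝ^{d×d} be continuously differentiable, and let g : U → ℝ^d be continuous. Let p, e : (0,∞)×(0,∞) → ℝ be continuously differentiable. Suppose that at every point of U the continuity equation ∂_t ϱ + div_x(ϱu) = 0, the momentum equation ∂_t(ϱu) + div_x(ϱ u⊗u) + ∇_x(p(ϱ,ϑ)) = div_x 𝕊 + ϱg, and the internal energy equation ∂_t(ϱ·e(ϱ,ϑ)) + div_x(ϱ·e(ϱ,ϑ)·u) + div_x q = 𝕊 : ∇_x u − p(ϱ,ϑ)·div_x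 u hold. Then at every point of U the total energy equation holds: ∂_t( (1/2)ϱ|u|² + ϱ·e(ϱ,ϑ) ) + div_x( ( (1/2)ϱ|u|² + ϱ·e(ϱ,ϑ) + p(ϱ,ϑ) )·u ) + div_x q − div_x(𝕊ᵀu) = ϱ·(g·u). -/
open Set Filter Topology

noncomputable section

/-- Time derivative `∂_t f` of a scalar field on `ℝ × ℝᵈ` (time × space). -/
def dt {d : ℕ} (f : ℝ × (Fin d → ℝ) → ℝ) (z : ℝ × (Fin d → ℝ)) : ℝ :=
  fderiv ℝ f z (1, 0)

/-- Spatial partial derivative `∂_{x_i} f` of a scalar field. -/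
def dxi {d : ℕ} (i : Fin d) (f : ℝ × (Fin d → ℝ) → ℝ) (z : ℝ × (Fin d → ℝ)) : ℝ :=
  fderiv ℝ f z (0, Pi.single i 1)

/-- Spatial divergence `div_x w` of a vector field. -/
def divx {d : ℕ} (w : ℝ × (Fin d → ℝ) → Fin d → ℝ) (z : ℝ × (Fin d → ℝ)) : ℝ :=
  ∑ i, dxi i (fun y => w y i) z

/-- Leibniz rule for a directional derivative of a product of scalar fields. -/
lemma fderiv_mul_apply_real {F : Type*} [NormedAddCommGroup F] [NormedSpace ℝ F]
    {a b : F → ℝ} {z : F} (ha : DifferentiableAt ℝ a z) (hb : DifferentiableAt ℝ b z) (v : F) :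
    fderiv ℝ (fun y => a y * b y) z v = fderiv ℝ a z v * b z + a z * fderiv ℝ b z v := by
  rw [fderiv_fun_mul ha hb]
  simp only [add_apply, smul_apply, smul_eq_mul]
  ring

/-- Directional derivative of the kinetic energy density `(1/2) ϱ |u|²`. -/
lemma fderiv_kinetic_apply {F ι : Type*} [NormedAddCommGroup F] [NormedSpace ℝ F] [Fintype ι]
    {ϱ : F → ℝ} {u : F → ι → ℝ} {z : F} (hϱ : DifferentiableAt ℝ ϱ z)
    (hu : ∀ i, DifferentiableAt ℝ (fun y => u y i) z) (v : F) :
    fderiv ℝ (fun y => 1 / 2 * ϱ y * ∑ i, u y i ^ 2) z v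
      = 1 / 2 * fderiv ℝ ϱ z v * (∑ i, u z i ^ 2)
        + ϱ z * ∑ i, u z i * fderiv ℝ (fun y => u y i) z v := by
  have hsq : ∀ i ∈ Finset.univ, DifferentiableAt ℝ (fun y => u y i ^ 2) z :=
    fun i _ => (hu i).pow 2
  have hsum : fderiv ℝ (fun y => ∑ i, u y i ^ 2) z v
      = 2 * ∑ i, u z i * fderiv ℝ (fun y => u y i) z v := by
    rw [fderiv_fun_sum hsq, sum_apply, Finset.mul_sum]
    refine Finset.sum_congr rfl fun i _ => ?_
    simp only [pow_two]
    rw [fderiv_mul_apply_real (hu i) (hu i)]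
    ring
  rw [fderiv_mul_apply_real (hϱ.const_mul _) (DifferentiableAt.fun_sum hsq), hsum,
    fderiv_const_mul hϱ]
  simp only [smul_apply, smul_eq_mul]
  ring

/-- Composing a `C¹` state function on the positive quadrant with positive differentiable fields
gives a differentiable field. -/
lemma differentiableAt_state_comp {F : Type*} [NormedAddCommGroup F] [NormedSpace ℝ F]
    {f : ℝ → ℝ → ℝ}
    (hf : ContDiffOn ℝ 1 (fun x : ℝ × ℝ => f x.1 x.2) {q : ℝ × ℝ | 0 < q.1 ∧ 0 < q.2})
    {a b : F → ℝ} {z : F} (ha : DifferentiableAt ℝ a z) (hb : DifferentiableAt ℝ b z)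
    (ha_pos : 0 < a z) (hb_pos : 0 < b z) :
    DifferentiableAt ℝ (fun y => f (a y) (b y)) z := by
  have hopen : IsOpen {q : ℝ × ℝ | 0 < q.1 ∧ 0 < q.2} :=
    (isOpen_lt continuous_const continuous_fst).inter (isOpen_lt continuous_const continuous_snd)
  have hd : DifferentiableAt ℝ (fun x : ℝ × ℝ => f x.1 x.2) (a z, b z) :=
    (hf.differentiableOn one_ne_zero).differentiableAt (hopen.mem_nhds ⟨ha_pos, hb_pos⟩)
  exact hd.comp z (ha.prodMk hb)

/-- `div_x (f w) = ∇_x f · w + f div_x w`. -/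
lemma divx_mul {d : ℕ} {f : ℝ × (Fin d → ℝ) → ℝ} {w : ℝ × (Fin d → ℝ) → Fin d → ℝ}
    {z : ℝ × (Fin d → ℝ)} (hf : DifferentiableAt ℝ f z)
    (hw : ∀ i, DifferentiableAt ℝ (fun y => w y i) z) :
    divx (fun y i => f y * w y i) z = (∑ i, dxi i f z * w z i) + f z * divx w z := by
  simp only [divx, dxi, Finset.mul_sum, ← Finset.sum_add_distrib]
  exact Finset.sum_congr rfl fun i _ => fderiv_mul_apply_real hf (hw i) _

/-- smooth solutions of the continuity equation, the momentum equation and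
the internal energy balance satisfy the total energy equation
`∂_t((1/2)ϱ|u|² + ϱe) + div_x(((1/2)ϱ|u|² + ϱe + p)u) + div_x q − div_x(𝕊ᵀu) = ϱ g·u`. -/
theorem total_energy_equation
    (d : ℕ) (hd : 1 ≤ d) (U : Set (ℝ × (Fin d → ℝ))) (hU : IsOpen U)
    (ϱ ϑ : ℝ × (Fin d → ℝ) → ℝ) (u q : ℝ × (Fin d → ℝ) → Fin d → ℝ)
    (𝕊 : ℝ × (Fin d → ℝ) → Fin d → Fin d → ℝ) (g : ℝ × (Fin d → ℝ) → Fin d → ℝ)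
    (hϱ : ContDiffOn ℝ 1 ϱ U) (hϑ : ContDiffOn ℝ 1 ϑ U)
    (hϱpos : ∀ z ∈ U, 0 < ϱ z) (hϑpos : ∀ z ∈ U, 0 < ϑ z)
    (hu : ContDiffOn ℝ 1 u U) (hq : ContDiffOn ℝ 1 q U)
    (h𝕊 : ContDiffOn ℝ 1 𝕊 U) (hg : ContinuousOn g U)
    (p e : ℝ → ℝ → ℝ)
    (hp : ContDiffOn ℝ 1 (fun x : ℝ × ℝ => p x.1 x.2) {q : ℝ × ℝ | 0 < q.1 ∧ 0 < q.2})
    (he : ContDiffOn ℝ 1 (fun x : ℝ × ℝ => e x.1 x.2) {q : ℝ × ℝ | 0 < q.1 ∧ 0 < q.2})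
    (hcont : ∀ z ∈ U, dt ϱ z + divx (fun y i => ϱ y * u y i) z = 0)
    (hmom : ∀ z ∈ U, ∀ i : Fin d,
      dt (fun y => ϱ y * u y i) z
        + divx (fun y j => ϱ y * u y i * u y j) z
        + dxi i (fun y => p (ϱ y) (ϑ y)) z
      = (∑ j, dxi j (fun y => 𝕊 y i j) z) + ϱ z * g z i)
    (hener : ∀ z ∈ U,
      dt (fun y => ϱ y * e (ϱ y) (ϑ y)) z
        + divx (fun y i => ϱ y * e (ϱ y) (ϑ y) * u y i) z
        + divx q z
      = (∑ i, ∑ j, 𝕊 z i j * dxi j (fun y => u y i) z)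
        - p (ϱ z) (ϑ z) * divx u z) :
    ∀ z ∈ U,
      dt (fun y => 1 / 2 * ϱ y * (∑ i, u y i ^ 2) + ϱ y * e (ϱ y) (ϑ y)) z
        + divx (fun y j =>
            (1 / 2 * ϱ y * (∑ i, u y i ^ 2) + ϱ y * e (ϱ y) (ϑ y) + p (ϱ y) (ϑ y))
              * u y j) z
        + divx q z
        - divx (fun y j => ∑ i, 𝕊 y i j * u y i) z
      = ϱ z * ∑ i, g z i * u z i := by
  intro z hz
  have hUz := hU.mem_nhds hz
  have dϱ : DifferentiableAt ℝ ϱ z := (hϱ.differentiableOn one_ne_zero).differentiableAt hUz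
  have dϑ : DifferentiableAt ℝ ϑ z := (hϑ.differentiableOn one_ne_zero).differentiableAt hUz
  have du : ∀ i, DifferentiableAt ℝ (fun y => u y i) z :=
    differentiableAt_pi.1 ((hu.differentiableOn one_ne_zero).differentiableAt hUz)
  have dS : ∀ i j, DifferentiableAt ℝ (fun y => 𝕊 y i j) z := fun i =>
    differentiableAt_pi.1
      (differentiableAt_pi.1 ((h𝕊.differentiableOn one_ne_zero).differentiableAt hUz) i)
  have dP : DifferentiableAt ℝ (fun y => p (ϱ y) (ϑ y)) z :=
    differentiableAt_state_comp hp dϱ dϑ (hϱpos z hz) (hϑpos z hz)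
  have dE : DifferentiableAt ℝ (fun y => ϱ y * e (ϱ y) (ϑ y)) z :=
    dϱ.mul (differentiableAt_state_comp he dϱ dϑ (hϱpos z hz) (hϑpos z hz))
  have dK : DifferentiableAt ℝ (fun y => 1 / 2 * ϱ y * ∑ i, u y i ^ 2) z :=
    (dϱ.const_mul _).mul (DifferentiableAt.fun_sum fun i _ => (du i).pow 2)
  have hc := hcont z hz
  have hen := hener z hz
  rw [divx_mul dϱ du] at hc
  rw [divx_mul dE du] at hen
  -- The momentum equation in convective form, by the continuity equation.
  have hconv : ∀ i, ϱ z * (dt (fun y => u y i) z + ∑ j, dxi j (fun y => u y i) z * u z j)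
      + dxi i (fun y => p (ϱ y) (ϑ y)) z
      = (∑ j, dxi j (fun y => 𝕊 y i j) z) + ϱ z * g z i := by
    intro i
    have h := hmom z hz i
    have hdt : dt (fun y => ϱ y * u y i) z = dt ϱ z * u z i + ϱ z * dt (fun y => u y i) z :=
      fderiv_mul_apply_real dϱ (du i) _
    have hdx : ∑ j, dxi j (fun y => ϱ y * u y i) z * u z j
        = u z i * (∑ j, dxi j ϱ z * u z j) + ϱ z * ∑ j, dxi j (fun y => u y i) z * u z j := by
      simp only [Finset.mul_sum, ← Finset.sum_add_distrib, dxi]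
      refine Finset.sum_congr rfl fun j _ => ?_
      rw [fderiv_mul_apply_real dϱ (du i)]
      ring
    rw [divx_mul (dϱ.fun_mul (du i)) du, hdt, hdx] at h
    linear_combination h - u z i * hc
  have hsum : ∑ i, u z i *
        (ϱ z * (dt (fun y => u y i) z + ∑ j, dxi j (fun y => u y i) z * u z j)
          + dxi i (fun y => p (ϱ y) (ϑ y)) z)
      = ∑ i, u z i * ((∑ j, dxi j (fun y => 𝕊 y i j) z) + ϱ z * g z i) :=
    Finset.sum_congr rfl fun i _ => by rw [hconv i]
  have hsum_left : ∑ i, u z i *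
        (ϱ z * (dt (fun y => u y i) z + ∑ j, dxi j (fun y => u y i) z * u z j)
          + dxi i (fun y => p (ϱ y) (ϑ y)) z)
      = ϱ z * (∑ i, u z i * dt (fun y => u y i) z)
        + ϱ z * (∑ j, (∑ i, u z i * dxi j (fun y => u y i) z) * u z j)
        + ∑ j, dxi j (fun y => p (ϱ y) (ϑ y)) z * u z j := by
    have hswap : ∑ j, (∑ i, u z i * dxi j (fun y => u y i) z) * u z j
        = ∑ i, u z i * ∑ j, dxi j (fun y => u y i) z * u z j := by
      simp only [Finset.sum_mul, Finset.mul_sum]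
      rw [Finset.sum_comm]
      simp only [mul_assoc]
    rw [hswap, Finset.mul_sum, Finset.mul_sum]
    simp only [← Finset.sum_add_distrib]
    exact Finset.sum_congr rfl fun i _ => by ring
  have hsum_right : ∑ i, u z i * ((∑ j, dxi j (fun y => 𝕊 y i j) z) + ϱ z * g z i)
      = (∑ i, u z i * ∑ j, dxi j (fun y => 𝕊 y i j) z) + ϱ z * ∑ i, g z i * u z i := by
    rw [Finset.mul_sum, ← Finset.sum_add_distrib]
    exact Finset.sum_congr rfl fun i _ => by ring
  have hstress : divx (fun y j => ∑ i, 𝕊 y i j * u y i) z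
      = (∑ i, u z i * ∑ j, dxi j (fun y => 𝕊 y i j) z)
        + ∑ i, ∑ j, 𝕊 z i j * dxi j (fun y => u y i) z := by
    simp only [divx, Finset.mul_sum, ← Finset.sum_add_distrib]
    rw [Finset.sum_comm]
    refine Finset.sum_congr rfl fun j _ => ?_
    simp only [dxi]
    rw [fderiv_fun_sum fun i _ => (dS i j).fun_mul (du i), sum_apply]
    refine Finset.sum_congr rfl fun i _ => ?_
    rw [fderiv_mul_apply_real (dS i j) (du i)]
    ring
  have htime : dt (fun y => 1 / 2 * ϱ y * (∑ i, u y i ^ 2) + ϱ y * e (ϱ y) (ϑ y)) z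
      = 1 / 2 * dt ϱ z * (∑ i, u z i ^ 2) + ϱ z * (∑ i, u z i * dt (fun y => u y i) z)
        + dt (fun y => ϱ y * e (ϱ y) (ϑ y)) z := by
    simp only [dt]
    rw [fderiv_fun_add dK dE, add_apply, fderiv_kinetic_apply dϱ du]
  have hgrad : ∑ j, dxi j (fun y => 1 / 2 * ϱ y * (∑ i, u y i ^ 2) + ϱ y * e (ϱ y) (ϑ y)
        + p (ϱ y) (ϑ y)) z * u z j
      = 1 / 2 * (∑ i, u z i ^ 2) * (∑ j, dxi j ϱ z * u z j)
        + ϱ z * (∑ j, (∑ i, u z i * dxi j (fun y => u y i) z) * u z j)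
        + (∑ j, dxi j (fun y => ϱ y * e (ϱ y) (ϑ y)) z * u z j)
        + ∑ j, dxi j (fun y => p (ϱ y) (ϑ y)) z * u z j := by
    rw [Finset.mul_sum _ _ (1 / 2 * ∑ i, u z i ^ 2), Finset.mul_sum _ _ (ϱ z)]
    simp only [← Finset.sum_add_distrib]
    refine Finset.sum_congr rfl fun j _ => ?_
    simp only [dxi]
    rw [fderiv_fun_add (dK.fun_add dE) dP, add_apply, fderiv_fun_add dK dE,
      add_apply, fderiv_kinetic_apply dϱ du]
    ring
  rw [hsum_left, hsum_right] at hsum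
  rw [htime, divx_mul ((dK.fun_add dE).fun_add dP) du, hgrad, hstress]
  linear_combination hsum + hen + 1 / 2 * (∑ i, u z i ^ 2) * hc

end
end

section
/- Let a > 0, let P : [0,∞) → ℝ be continuously differentiable with (5/3)P(Z) − P'(Z)·Z > 0 for all Z > 0 and ((5/3)P(Z) − P'(Z)·Z)/Z < c for all Z > 0 for some c > 0, and let 𝒮 : (0,∞) → ℝ be continuously differentiable with 𝒮'(Z) = −(3/2)·((5/3)P(Z) − P'(Z)·Z)/Z². Define s(ϱ,ϑ) = 𝒮(ϱ·ϑ^{−3/2}) + (4a/3)·(ϑ³/ϱ). Then there exists a constant C > 0 such that for all ϱ > 0 and all ϑ ≥ 1: |ϱ·s(ϱ,ϑ)| ≤ C·( 1 + ϱ·(1 + |log ϱ|) + ϑ³ ). -/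
open Set Filter Topology

noncomputable section

/-- Specific entropy of the Navier–Stokes–Fourier system:
`s(ϱ,ϑ) = 𝒮(ϱ ϑ^{-3/2}) + (4a/3) ϑ³/ϱ`. -/
def sNSF (a : ℝ) (S : ℝ → ℝ) (ρ θ : ℝ) : ℝ :=
  S (ρ * θ ^ (-(3 : ℝ) / 2)) + 4 * a / 3 * (θ ^ 3 / ρ)

/-- A function on `(0, ∞)` whose derivative lies between `-K / Z` and `0` grows at most
logarithmically. -/
theorem abs_le_add_mul_abs_log {f f' : ℝ → ℝ} {K : ℝ}
    (hf : ∀ Z : ℝ, 0 < Z → HasDerivAt f (f' Z) Z)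
    (hneg : ∀ Z : ℝ, 0 < Z → f' Z ≤ 0) (hlow : ∀ Z : ℝ, 0 < Z → -(K / Z) ≤ f' Z)
    {Z : ℝ} (hZ : 0 < Z) : |f Z| ≤ |f 1| + K * |Real.log Z| := by
  have hg : ∀ Z : ℝ, 0 < Z →
      HasDerivAt (fun x => f x + K * Real.log x) (f' Z + K * Z⁻¹) Z := fun Z hZ =>
    (hf Z hZ).add ((Real.hasDerivAt_log hZ.ne').const_mul K)
  have anti : AntitoneOn f (Set.Ioi 0) := by
    refine antitoneOn_of_deriv_nonpos (convex_Ioi 0)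
      (fun x hx => (hf x hx).continuousAt.continuousWithinAt) ?_ ?_ <;> rw [interior_Ioi]
    · exact fun x hx => (hf x hx).differentiableAt.differentiableWithinAt
    · exact fun x hx => (hf x hx).deriv ▸ hneg x hx
  have mono : MonotoneOn (fun x => f x + K * Real.log x) (Set.Ioi 0) := by
    refine monotoneOn_of_deriv_nonneg (convex_Ioi 0)
      (fun x hx => (hg x hx).continuousAt.continuousWithinAt) ?_ ?_ <;> rw [interior_Ioi]
    · exact fun x hx => (hg x hx).differentiableAt.differentiableWithinAt
    · intro x hx
      rw [(hg x hx).deriv, ← div_eq_mul_inv]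
      linarith [hlow x hx]
  have h1 : (1 : ℝ) ∈ Set.Ioi (0 : ℝ) := Set.mem_Ioi.2 one_pos
  have hlo := neg_abs_le (f 1)
  have hhi := le_abs_self (f 1)
  rcases le_total 1 Z with h | h
  · have ha := anti h1 hZ h
    have hm := mono h1 hZ h
    have hl := Real.log_nonneg h
    simp only [Real.log_one, mul_zero, add_zero] at hm
    rw [abs_of_nonneg hl, abs_le]
    constructor <;> linarith
  · have ha := anti hZ h1 h
    have hm := mono hZ h1 h
    have hl := Real.log_nonpos hZ.le h
    simp only [Real.log_one, mul_zero, add_zero] at hm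
    rw [abs_of_nonpos hl, abs_le]
    constructor <;> linarith

theorem mul_log_le_mul_abs_log_add_cube {ρ θ : ℝ} (hρ : 0 < ρ) (hθ : 1 ≤ θ) :
    ρ * Real.log θ ≤ ρ * |Real.log ρ| + θ ^ 3 := by
  have hθ0 : 0 < θ := by linarith
  rcases le_total ρ θ with h | h
  · have h1 : ρ * Real.log θ ≤ θ * θ :=
      mul_le_mul h (Real.log_le_self hθ0.le) (Real.log_nonneg hθ) hθ0.le
    have h2 : θ * θ ≤ θ ^ 3 := by nlinarith [mul_pos hθ0 hθ0]
    have h3 : 0 ≤ ρ * |Real.log ρ| := by positivity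
    linarith
  · have h1 : Real.log θ ≤ |Real.log ρ| := (Real.log_le_log hθ0 h).trans (le_abs_self _)
    have h2 := mul_le_mul_of_nonneg_left h1 hρ.le
    have h3 : 0 < θ ^ 3 := by positivity
    linarith

/-- pointwise bound on the total entropy `ϱ s(ϱ,ϑ)` for `ϑ ≥ 1`:
`|ϱ s(ϱ,ϑ)| ≤ C (1 + ϱ(1 + |log ϱ|) + ϑ³)`. -/
theorem total_entropy_pointwise_bound
    (a c : ℝ) (ha : 0 < a) (hc : 0 < c) (P 𝒮 : ℝ → ℝ)
    (hP : ContDiffOn ℝ 1 P (Set.Ici 0))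
    (hstab : ∀ Z : ℝ, 0 < Z → 0 < 5 / 3 * P Z - deriv P Z * Z)
    (hbd : ∀ Z : ℝ, 0 < Z → (5 / 3 * P Z - deriv P Z * Z) / Z < c)
    (h𝒮 : ∀ Z : ℝ, 0 < Z →
      HasDerivAt 𝒮 (-(3 / 2) * (5 / 3 * P Z - deriv P Z * Z) / Z ^ 2) Z) :
    ∃ C > (0 : ℝ), ∀ ρ θ : ℝ, 0 < ρ → 1 ≤ θ →
      |ρ * sNSF a 𝒮 ρ θ| ≤ C * (1 + ρ * (1 + |Real.log ρ|) + θ ^ 3) := by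
  set K : ℝ := 3 / 2 * c with hK
  have hK0 : 0 < K := by positivity
  have hS : ∀ Z : ℝ, 0 < Z → |𝒮 Z| ≤ |𝒮 1| + K * |Real.log Z| := fun Z hZ => by
    refine abs_le_add_mul_abs_log h𝒮 (fun Z hZ => ?_) (fun Z hZ => ?_) hZ
    · exact div_nonpos_of_nonpos_of_nonneg (by linarith [hstab Z hZ]) (by positivity)
    · have h := div_le_div_of_nonneg_right (hbd Z hZ).le hZ.le
      have e : -(3 / 2) * (5 / 3 * P Z - deriv P Z * Z) / Z ^ 2 =
          -(3 / 2) * ((5 / 3 * P Z - deriv P Z * Z) / Z / Z) := by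
        field_simp
      have e2 : K / Z = 3 / 2 * (c / Z) := by rw [hK]; ring
      rw [e, e2]
      linarith
  refine ⟨|𝒮 1| + 5 / 2 * K + 4 * a / 3, by positivity, fun ρ θ hρ hθ => ?_⟩
  have hθ0 : 0 < θ := by linarith
  have hpow : 0 < θ ^ (-(3 : ℝ) / 2) := Real.rpow_pos_of_pos hθ0 _
  have hlogθ := Real.log_nonneg hθ
  have hlog : |Real.log (ρ * θ ^ (-(3 : ℝ) / 2))| ≤ |Real.log ρ| + 3 / 2 * Real.log θ := by
    rw [Real.log_mul hρ.ne' hpow.ne', Real.log_rpow hθ0]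
    refine (abs_add_le _ _).trans_eq ?_
    rw [abs_mul, abs_of_nonneg hlogθ]
    norm_num
  have hSZ : |𝒮 (ρ * θ ^ (-(3 : ℝ) / 2))| ≤
      |𝒮 1| + K * (|Real.log ρ| + 3 / 2 * Real.log θ) :=
    (hS _ (mul_pos hρ hpow)).trans (by gcongr)
  have hsplit : ρ * sNSF a 𝒮 ρ θ =
      ρ * 𝒮 (ρ * θ ^ (-(3 : ℝ) / 2)) + 4 * a / 3 * θ ^ 3 := by
    unfold sNSF
    field_simp
  have hcross := mul_le_mul_of_nonneg_left (mul_log_le_mul_abs_log_add_cube hρ hθ) hK0.le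
  have hθ3 : 0 < θ ^ 3 := by positivity
  calc |ρ * sNSF a 𝒮 ρ θ|
      ≤ ρ * |𝒮 (ρ * θ ^ (-(3 : ℝ) / 2))| + 4 * a / 3 * θ ^ 3 := by
        rw [hsplit]
        refine (abs_add_le _ _).trans_eq ?_
        rw [abs_mul, abs_of_pos hρ, abs_of_pos (by positivity : 0 < 4 * a / 3 * θ ^ 3)]
    _ ≤ ρ * (|𝒮 1| + K * (|Real.log ρ| + 3 / 2 * Real.log θ)) + 4 * a / 3 * θ ^ 3 := by
        gcongr
    _ ≤ |𝒮 1| * ρ + 5 / 2 * K * (ρ * |Real.log ρ| + θ ^ 3) + 4 * a / 3 * θ ^ 3 := by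
        have : 0 < K * θ ^ 3 := by positivity
        linarith
    _ ≤ (|𝒮 1| + 5 / 2 * K + 4 * a / 3) * (1 + ρ * (1 + |Real.log ρ|) + θ ^ 3) := by
        have hl : 0 ≤ ρ * |Real.log ρ| := by positivity
        have h1 : |𝒮 1| * ρ ≤ |𝒮 1| * (1 + ρ * (1 + |Real.log ρ|) + θ ^ 3) := by
          gcongr; linarith
        have h2 : 5 / 2 * K * (ρ * |Real.log ρ| + θ ^ 3) ≤
            5 / 2 * K * (1 + ρ * (1 + |Real.log ρ|) + θ ^ 3) := by
          gcongr; linarith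
        have h3 : 4 * a / 3 * θ ^ 3 ≤
            4 * a / 3 * (1 + ρ * (1 + |Real.log ρ|) + θ ^ 3) := by
          gcongr; linarith
        linarith

end
end
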